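/- arXiv:1908.05088 — 2 statements merged into one kernel-verified Lean document; each statement's English description precedes it below -/
import Mathlib

section
/- For every ε > 0 and every z ∈ ℂ with z ≠ 0, there exists y ∈ ℂ with y ≠ 0 such that |arg(y) − π/4| < ε and f(f(y)) = z. -/
open Complex Set Metric Bornology Function

noncomputable section

/-- The exponential map `z ↦ λ·e^z`. -/
def expMap (lam : ℂ) : ℂ → ℂ := fun z => lam * Complex.exp z

/-- If `y n` stays within bounded distance of `R n * (1 + i)` and `R n → ∞`, then
`arg (y n) → π / 4`. -/
theorem tendsto_arg_of_norm_sub_le {y : ℕ → ℂ} {R : ℕ → ℝ} {C : ℝ}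
    (hR : Filter.Tendsto R Filter.atTop Filter.atTop)
    (h : ∀ n, ‖y n - R n * (1 + I)‖ ≤ C) :
    Filter.Tendsto (fun n => arg (y n)) Filter.atTop (nhds (Real.pi / 4)) := by
  have hlim : Filter.Tendsto (fun n => ((R n)⁻¹ : ℝ) * y n) Filter.atTop (nhds (1 + I)) := by
    rw [tendsto_iff_norm_sub_tendsto_zero]
    refine squeeze_zero' (Filter.Eventually.of_forall fun n => norm_nonneg _) ?_
      (by simpa using hR.inv_tendsto_atTop.mul_const C)
    filter_upwards [hR.eventually_gt_atTop 0] with n hn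
    have hne : (R n : ℂ) ≠ 0 := by exact_mod_cast hn.ne'
    have heq : ((R n)⁻¹ : ℝ) * y n - (1 + I) = ((R n)⁻¹ : ℝ) * (y n - R n * (1 + I)) := by
      push_cast
      field_simp
    rw [heq, norm_mul, Complex.norm_of_nonneg (inv_nonneg.2 hn.le)]
    exact mul_le_mul_of_nonneg_left (h n) (inv_nonneg.2 hn.le)
  have harg : arg (1 + I) = Real.pi / 4 := by
    rw [Complex.arg_of_re_nonneg (by simp), ← Real.arcsin_sin (x := Real.pi / 4)
      (by linarith [Real.pi_pos]) (by linarith [Real.pi_pos]), Real.sin_pi_div_four]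
    have hnorm : ‖(1 + I : ℂ)‖ = √2 := by
      rw [Complex.norm_def, Complex.normSq_apply]
      norm_num
    rw [hnorm]
    simp [Real.sqrt_div_self]
  have hcont : ContinuousAt arg (1 + I) := Complex.continuousAt_arg (by simp [slitPlane])
  rw [← harg]
  refine (hcont.tendsto.comp hlim).congr' ?_
  filter_upwards [hR.eventually_gt_atTop 0] with n hn
  exact Complex.arg_real_mul _ (inv_pos.2 hn)

/-- Every nonzero `v` has a logarithm within `3π` of `log ‖v‖ * (1 + i)`. -/
theorem exists_exp_eq_norm_sub_le {v : ℂ} (hv : v ≠ 0) :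
    ∃ y : ℂ, exp y = v ∧ ‖y - (Real.log ‖v‖ : ℂ) * (1 + I)‖ ≤ 3 * Real.pi := by
  set R := Real.log ‖v‖ with hR
  set m : ℤ := ⌊R / (2 * Real.pi)⌋
  have hpi := Real.pi_pos
  refine ⟨log v + m * (2 * Real.pi * I), ?_, ?_⟩
  · rw [Complex.exp_add, Complex.exp_log hv, Complex.exp_int_mul_two_pi_mul_I, mul_one]
  · have heq : log v + m * (2 * Real.pi * I) - (R : ℂ) * (1 + I) =
        ((arg v + m * (2 * Real.pi) - R : ℝ) : ℂ) * I := by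
      rw [Complex.log, ← hR]
      push_cast
      ring
    have hlow : (m : ℝ) * (2 * Real.pi) ≤ R :=
      (le_div_iff₀ (by positivity)).1 (Int.floor_le _)
    have hupp : R < (m + 1 : ℝ) * (2 * Real.pi) :=
      (div_lt_iff₀ (by positivity)).1 (Int.lt_floor_add_one _)
    rw [heq, norm_mul, norm_I, mul_one, Complex.norm_real, Real.norm_eq_abs, abs_le]
    constructor <;> linarith [neg_pi_lt_arg v, arg_le_pi v]

/-- For every `ε > 0` and every nonzero `z ∈ ℂ`, there is a nonzero
`y ∈ ℂ` with `|arg y − π/4| < ε` and `f(f(y)) = z`, where `f = expMap lam`. -/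
theorem statement3 (lam : ℂ) (hlam : lam ≠ 0) (ε : ℝ) (hε : 0 < ε)
    (z : ℂ) (hz : z ≠ 0) :
    ∃ y : ℂ, y ≠ 0 ∧ |Complex.arg y - Real.pi / 4| < ε ∧
      expMap lam (expMap lam y) = z := by
  set w : ℕ → ℂ := fun n => log (z / lam) + n * (2 * Real.pi * I) with hw
  have hexp (n : ℕ) : exp (w n) = z / lam := by
    rw [hw, Complex.exp_add, Complex.exp_log (div_ne_zero hz hlam),
      Complex.exp_nat_mul_two_pi_mul_I, mul_one]
  have hnorm : Filter.Tendsto (fun n => ‖w n‖) Filter.atTop Filter.atTop := by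
    refine Filter.tendsto_atTop_mono (f := fun n : ℕ => (n : ℝ) * (2 * Real.pi) + arg (z / lam))
      (fun n => ?_) ?_
    · refine le_trans (le_of_eq ?_) ((le_abs_self _).trans (abs_im_le_norm (w n)))
      simp [hw, Complex.log_im, add_comm]
    · exact Filter.tendsto_atTop_add_const_right _ _
        (tendsto_natCast_atTop_atTop.atTop_mul_const Real.two_pi_pos)
  obtain ⟨N, hN⟩ := Filter.eventually_atTop.1 (hnorm.eventually_gt_atTop 0)
  have hne (n : ℕ) : w (n + N) / lam ≠ 0 :=
    div_ne_zero (norm_pos_iff.1 (hN _ (Nat.le_add_left N n))) hlam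
  have hR : Filter.Tendsto (fun n => Real.log ‖w (n + N) / lam‖) Filter.atTop Filter.atTop := by
    simp only [norm_div]
    exact Real.tendsto_log_atTop.comp
      ((hnorm.comp (Filter.tendsto_add_atTop_nat N)).atTop_div_const (norm_pos_iff.2 hlam))
  choose y hy hyR using fun n => exists_exp_eq_norm_sub_le (hne n)
  have harg := tendsto_arg_of_norm_sub_le hR hyR
  obtain ⟨n, hclose, hpos⟩ := ((Metric.tendsto_nhds.1 harg ε hε).and
    (harg.eventually_const_lt (by positivity : (0 : ℝ) < Real.pi / 4))).exists
  refine ⟨y n, ?_, hclose, ?_⟩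
  · intro h0
    simp [h0] at hpos
  · simp only [expMap]
    rw [hy, mul_div_cancel₀ _ hlam, hexp, mul_div_cancel₀ _ hlam]
end
end

section
/- For every ε > 0 and every z ∈ ℂ with z ≠ 0 there exist four closed circular arcs centred at the origin, C_j = {r_j·e^{iθ} : θ ∈ [α_j, β_j]} with r_j > 0 and α_j ≤ β_j (j = 1, …, 4), such that: (a) Γ := f(f(C₁ ∪ C₂ ∪ C₃ ∪ C₄)) is a Jordan curve; (b) the diameter of Γ is at most ε; (c) z lies in a bounded connected component of ℂ \ Γ; (d) whenever i ≠ j and p ∈ f(f(C_i)) ∩ f(f(C_j)), the two image curves cross transversally at p, in the sense that for all w ∈ C_i and w' ∈ C_j with f(f(w)) = f(f(w')) = p, the tangent vectors (f∘f)'(w)·(i·w) and (f∘f)'(w')·(i·w') are linearly independent over ℝ. -/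
open Complex Set Metric Bornology Function

noncomputable section

/-- A Jordan curve: the image of the unit circle under a continuous injective map,
parametrised periodically by `ℝ` (via `t ↦ h(e^{it})`). -/
def IsJordanCurve (H : Set ℂ) : Prop :=
  ∃ h : ℝ → ℂ, Continuous h ∧ Function.Periodic h (2 * Real.pi) ∧
    Set.InjOn h (Set.Ico 0 (2 * Real.pi)) ∧ H = Set.range h

/-- The closed circular arc `{r·e^{iθ} : θ ∈ [α, β]}` centred at the origin. -/
def circArc (r α β : ℝ) : Set ℂ :=
  (fun θ : ℝ => (r : ℂ) * Complex.exp (θ * Complex.I)) '' Set.Icc α β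

/-- The boundary of the unit square, parametrised by the angle. -/
def squareLoop (t : ℝ) : ℝ × ℝ :=
  ‖(Real.cos t, Real.sin t)‖⁻¹ • (Real.cos t, Real.sin t)

lemma norm_cos_sin_pos (t : ℝ) : 0 < ‖(Real.cos t, Real.sin t)‖ := by
  rw [norm_pos_iff]
  intro h
  have h1 := congrArg Prod.fst h
  have h2 := congrArg Prod.snd h
  have h3 := Real.cos_sq_add_sin_sq t
  simp only [Prod.fst_zero, Prod.snd_zero] at h1 h2
  rw [h1, h2] at h3
  norm_num at h3

lemma continuous_squareLoop : Continuous squareLoop := by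
  unfold squareLoop
  refine Continuous.smul (Continuous.inv₀ (by fun_prop) fun t => (norm_cos_sin_pos t).ne') ?_
  fun_prop

lemma periodic_squareLoop : Function.Periodic squareLoop (2 * Real.pi) := by
  intro t
  simp [squareLoop]

lemma injOn_squareLoop : Set.InjOn squareLoop (Set.Ico 0 (2 * Real.pi)) := by
  intro s hs t ht h
  have ha := inv_pos.2 (norm_cos_sin_pos s)
  have hb := inv_pos.2 (norm_cos_sin_pos t)
  have h1 := congrArg Prod.fst h
  have h2 := congrArg Prod.snd h
  simp only [squareLoop, Prod.smul_fst, Prod.smul_snd, smul_eq_mul] at h1 h2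
  set a := ‖(Real.cos s, Real.sin s)‖⁻¹
  set b := ‖(Real.cos t, Real.sin t)‖⁻¹
  have hab : a ^ 2 = b ^ 2 := by
    linear_combination (a * Real.cos s + b * Real.cos t) * h1 +
      (a * Real.sin s + b * Real.sin t) * h2 - a ^ 2 * Real.cos_sq_add_sin_sq s +
      b ^ 2 * Real.cos_sq_add_sin_sq t
  have hab' : a = b := (pow_left_inj₀ ha.le hb.le two_ne_zero).1 hab
  rw [hab'] at h1 h2
  have hc := mul_left_cancel₀ hb.ne' h1
  have hd := mul_left_cancel₀ hb.ne' h2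
  have hang := Real.Angle.cos_sin_inj hc hd
  obtain ⟨k, hk⟩ := Real.Angle.angle_eq_iff_two_pi_dvd_sub.1 hang
  have hpi := Real.pi_pos
  have hk1 : (k : ℝ) < 1 := by
    by_contra! hcon
    nlinarith [hs.1, hs.2, ht.1, ht.2]
  have hk2 : (-1 : ℝ) < k := by
    by_contra! hcon
    nlinarith [hs.1, hs.2, ht.1, ht.2]
  have hk0 : k = 0 := by
    have h3 : k < 1 := by exact_mod_cast hk1
    have h4 : -1 < k := by exact_mod_cast hk2
    omega
  rw [hk0] at hk
  simp only [Int.cast_zero, mul_zero] at hk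
  linarith

lemma range_squareLoop : Set.range squareLoop = Metric.sphere 0 1 := by
  ext p
  rw [mem_sphere_zero_iff_norm]
  constructor
  · rintro ⟨t, rfl⟩
    rw [squareLoop, norm_smul, norm_inv, norm_norm, inv_mul_cancel₀ (norm_cos_sin_pos t).ne']
  · intro hp
    set q : ℂ := ⟨p.1, p.2⟩ with hq
    have hq0 : q ≠ 0 := by
      intro h
      have h1 := congrArg Complex.re h
      have h2 := congrArg Complex.im h
      have : p = 0 := Prod.ext h1 h2
      rw [this] at hp
      simp at hp
    have hn : 0 < ‖q‖ := norm_pos_iff.2 hq0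
    have hpe : (Real.cos q.arg, Real.sin q.arg) = ‖q‖⁻¹ • p := by
      rw [Complex.cos_arg hq0, Complex.sin_arg]
      ext <;> simp [hq, div_eq_inv_mul]
    refine ⟨q.arg, ?_⟩
    rw [squareLoop, hpe, norm_smul, hp, mul_one, norm_inv, norm_norm, inv_inv, smul_smul,
      mul_inv_cancel₀ hn.ne', one_smul]

lemma isJordanCurve_image_sphere {Ψ : ℝ × ℝ → ℂ} {c : ℝ × ℝ} {δ : ℝ} (hδ : 0 < δ)
    (hcont : ContinuousOn Ψ (Metric.closedBall c δ)) (hinj : InjOn Ψ (Metric.closedBall c δ)) :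
    IsJordanCurve (Ψ '' Metric.sphere c δ) := by
  have hmem (t : ℝ) : c + δ • squareLoop t ∈ Metric.sphere c δ := by
    have : squareLoop t ∈ Metric.sphere (0 : ℝ × ℝ) 1 := range_squareLoop ▸ mem_range_self t
    rw [mem_sphere_zero_iff_norm] at this
    simp [mem_sphere_iff_norm, norm_smul, this, abs_of_pos hδ]
  have hmem' (t : ℝ) := sphere_subset_closedBall (hmem t)
  refine ⟨fun t => Ψ (c + δ • squareLoop t), ?_, ?_, ?_, ?_⟩
  · have := continuous_squareLoop
    exact hcont.comp_continuous (by fun_prop) hmem'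
  · intro t
    simp only [periodic_squareLoop t]
  · intro s hs t ht h
    have h1 := add_left_cancel (hinj (hmem' s) (hmem' t) h)
    exact injOn_squareLoop hs ht (smul_right_injective _ hδ.ne' h1)
  · ext w
    constructor
    · rintro ⟨p, hp, rfl⟩
      have : δ⁻¹ • (p - c) ∈ range squareLoop := by
        rw [range_squareLoop, mem_sphere_zero_iff_norm, norm_smul, mem_sphere_iff_norm.1 hp]
        simp [abs_of_pos hδ, hδ.ne']
      obtain ⟨t, ht⟩ := this
      refine ⟨t, ?_⟩
      simp only [ht, smul_smul, mul_inv_cancel₀ hδ.ne', one_smul, add_sub_cancel]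
    · rintro ⟨t, rfl⟩
      exact mem_image_of_mem _ (hmem t)

lemma isBounded_connectedComponentIn_compl_image_sphere {Ψ : ℝ × ℝ → ℂ} {c : ℝ × ℝ} {δ : ℝ}
    (hδ : 0 < δ) (hcont : ContinuousOn Ψ (Metric.closedBall c δ))
    (hinj : InjOn Ψ (Metric.closedBall c δ)) (hopen : IsOpen (Ψ '' Metric.ball c δ)) :
    Ψ c ∉ Ψ '' Metric.sphere c δ ∧
      IsBounded (connectedComponentIn (Ψ '' Metric.sphere c δ)ᶜ (Ψ c)) := by
  have hc : Ψ c ∉ Ψ '' Metric.sphere c δ := by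
    rintro ⟨p, hp, h⟩
    have := hinj (sphere_subset_closedBall hp) (mem_closedBall_self hδ.le) h
    rw [this, mem_sphere, dist_self] at hp
    exact hδ.ne hp
  refine ⟨hc, ?_⟩
  have hK : IsCompact (Ψ '' Metric.closedBall c δ) :=
    (isCompact_closedBall c δ).image_of_continuousOn hcont
  refine (hK.isBounded.subset (image_mono ball_subset_closedBall)).subset ?_
  refine isPreconnected_connectedComponentIn.subset_left_of_subset_union hopen
    hK.isClosed.isOpen_compl ?_ ?_ ⟨Ψ c, mem_connectedComponentIn hc,
      mem_image_of_mem _ (mem_ball_self hδ)⟩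
  · exact (disjoint_compl_right).mono_left (image_mono ball_subset_closedBall)
  · refine (connectedComponentIn_subset _ _).trans ?_
    intro w hw
    by_cases h : w ∈ Ψ '' Metric.closedBall c δ
    · left
      obtain ⟨p, hp, rfl⟩ := h
      rw [← ball_union_sphere] at hp
      exact hp.elim (mem_image_of_mem _) fun h => absurd (mem_image_of_mem _ h) hw
    · exact Or.inr h

lemma circArc_eq_image {r b₁ b₂ : ℝ} (hr : 0 < r) (h₁ : -r ≤ b₁) (h₁₂ : b₁ ≤ b₂) (h₂ : b₂ ≤ r) :
    circArc r (Real.arcsin (b₁ / r)) (Real.arcsin (b₂ / r)) =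
      (fun y : ℝ => (⟨√(r ^ 2 - y ^ 2), y⟩ : ℂ)) '' Icc b₁ b₂ := by
  have key (θ : ℝ) (hθ : θ ∈ Icc (-(Real.pi / 2)) (Real.pi / 2)) :
      (r : ℂ) * Complex.exp (θ * Complex.I) =
        ⟨√(r ^ 2 - (r * Real.sin θ) ^ 2), r * Real.sin θ⟩ := by
    have hcos := Real.cos_nonneg_of_mem_Icc hθ
    have hsq : r ^ 2 - (r * Real.sin θ) ^ 2 = (r * Real.cos θ) ^ 2 := by
      linear_combination (- r ^ 2) * Real.cos_sq_add_sin_sq θ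
    rw [hsq, Real.sqrt_sq (by positivity)]
    apply Complex.ext <;>
      simp [Complex.exp_ofReal_mul_I_re, Complex.exp_ofReal_mul_I_im]
  have hdiv (y : ℝ) (hy : y ∈ Icc b₁ b₂) : -1 ≤ y / r ∧ y / r ≤ 1 := by
    rw [le_div_iff₀ hr, div_le_iff₀ hr]
    constructor <;> linarith [hy.1, hy.2]
  have hb₁ := hdiv b₁ ⟨le_rfl, h₁₂⟩
  have hb₂ := hdiv b₂ ⟨h₁₂, le_rfl⟩
  ext w
  constructor
  · rintro ⟨θ, hθ, rfl⟩
    have hθ' : θ ∈ Icc (-(Real.pi / 2)) (Real.pi / 2) :=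
      ⟨(Real.neg_pi_div_two_le_arcsin _).trans hθ.1, hθ.2.trans (Real.arcsin_le_pi_div_two _)⟩
    refine ⟨r * Real.sin θ, ?_, (key θ hθ').symm⟩
    have e1 := (Real.arcsin_le_iff_le_sin hb₁ hθ').1 hθ.1
    have e2 := (Real.le_arcsin_iff_sin_le hθ' hb₂).1 hθ.2
    rw [div_le_iff₀ hr] at e1
    rw [le_div_iff₀ hr] at e2
    constructor <;> linarith
  · rintro ⟨y, hy, rfl⟩
    have hyr := hdiv y hy
    refine ⟨Real.arcsin (y / r), ⟨Real.monotone_arcsin (by gcongr; exact hy.1),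
      Real.monotone_arcsin (by gcongr; exact hy.2)⟩, ?_⟩
    simp only
    rw [key _ (Real.arcsin_mem_Icc _), Real.sin_arcsin hyr.1 hyr.2, mul_div_cancel₀ _ hr.ne']

/-- The imaginary part of a point `w` with `‖w‖² = P.1` and `‖w + 2πi‖² = P.2`. -/
def bipolarIm (P : ℝ × ℝ) : ℝ := (P.2 - P.1 - 4 * Real.pi ^ 2) / (4 * Real.pi)

/-- The point `w` of the right half-plane with `‖w‖² = P.1` and `‖w + 2πi‖² = P.2`. -/
def bipolarPt (P : ℝ × ℝ) : ℂ := ⟨√(P.1 - bipolarIm P ^ 2), bipolarIm P⟩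

/-- The squared distances of `w` to `0` and to `-2πi`. -/
def bipolarCoord (w : ℂ) : ℝ × ℝ :=
  (w.re ^ 2 + w.im ^ 2, w.re ^ 2 + (w.im + 2 * Real.pi) ^ 2)

lemma continuous_bipolarIm : Continuous bipolarIm := by
  unfold bipolarIm
  fun_prop

lemma continuous_bipolarPt : Continuous bipolarPt := by
  have h := continuous_bipolarIm
  have : Continuous fun P : ℝ × ℝ => (√(P.1 - bipolarIm P ^ 2), bipolarIm P) := by fun_prop
  exact Complex.equivRealProdCLM.symm.continuous.comp this

lemma continuous_bipolarCoord : Continuous bipolarCoord := by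
  unfold bipolarCoord
  fun_prop

lemma bipolarIm_bipolarCoord (w : ℂ) : bipolarIm (bipolarCoord w) = w.im := by
  have := Real.pi_pos
  simp only [bipolarIm, bipolarCoord]
  field_simp
  ring

lemma bipolarPt_bipolarCoord {w : ℂ} (hw : 0 < w.re) : bipolarPt (bipolarCoord w) = w := by
  rw [bipolarPt, bipolarIm_bipolarCoord]
  apply Complex.ext
  · simp [bipolarCoord, Real.sqrt_sq hw.le]
  · rfl

lemma bipolarPt_re_pos {P : ℝ × ℝ} (hP : bipolarIm P ^ 2 < P.1) : 0 < (bipolarPt P).re :=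
  Real.sqrt_pos.2 (sub_pos.2 hP)

lemma bipolarCoord_bipolarPt {P : ℝ × ℝ} (hP : bipolarIm P ^ 2 < P.1) :
    bipolarCoord (bipolarPt P) = P := by
  have := Real.pi_pos
  apply Prod.ext
  · simp only [bipolarCoord, bipolarPt, Real.sq_sqrt (sub_pos.2 hP).le]
    ring
  · simp only [bipolarCoord, bipolarPt, Real.sq_sqrt (sub_pos.2 hP).le]
    simp only [bipolarIm]
    field_simp
    ring

lemma image_bipolarPt_vertical {u v₁ v₂ : ℝ} (hv : v₁ ≤ v₂)
    (h₁ : bipolarIm (u, v₁) ^ 2 < u) (h₂ : bipolarIm (u, v₂) ^ 2 < u) :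
    circArc √u (Real.arcsin (bipolarIm (u, v₁) / √u)) (Real.arcsin (bipolarIm (u, v₂) / √u)) =
      bipolarPt '' ({u} ×ˢ Icc v₁ v₂) := by
  have hpi := Real.pi_pos
  have hu : 0 < u := (sq_nonneg _).trans_lt h₁
  have e₁ := abs_le.1 (Real.abs_le_sqrt h₁.le)
  have e₂ := abs_le.1 (Real.abs_le_sqrt h₂.le)
  rw [circArc_eq_image (Real.sqrt_pos.2 hu) e₁.1 (by unfold bipolarIm; gcongr) e₂.2,
    Real.sq_sqrt hu.le]
  ext w
  constructor
  · rintro ⟨y, hy, rfl⟩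
    have hy' : bipolarIm (u, u + 4 * Real.pi * y + 4 * Real.pi ^ 2) = y := by
      simp only [bipolarIm]
      field_simp
      ring
    refine ⟨(u, u + 4 * Real.pi * y + 4 * Real.pi ^ 2), ⟨rfl, ?_⟩, by simp only [bipolarPt, hy']⟩
    simp only [bipolarIm, mem_Icc, div_le_iff₀ (show 0 < 4 * Real.pi by positivity),
      le_div_iff₀ (show 0 < 4 * Real.pi by positivity)] at hy
    constructor <;> linarith
  · rintro ⟨⟨u', v⟩, ⟨rfl : u' = u, hv'⟩, rfl⟩
    refine ⟨bipolarIm (u', v), ⟨?_, ?_⟩, rfl⟩ <;> unfold bipolarIm <;> gcongr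
    exacts [hv'.1, hv'.2]

lemma image_bipolarPt_horizontal {u₁ u₂ v : ℝ} (hu : u₁ ≤ u₂)
    (h₁ : bipolarIm (u₁, v) ^ 2 < u₁) (h₂ : bipolarIm (u₂, v) ^ 2 < u₂) :
    circArc √v (Real.arcsin ((bipolarIm (u₂, v) + 2 * Real.pi) / √v))
        (Real.arcsin ((bipolarIm (u₁, v) + 2 * Real.pi) / √v)) =
      (fun P => bipolarPt P + 2 * Real.pi * Complex.I) '' (Icc u₁ u₂ ×ˢ {v}) := by
  have hpi := Real.pi_pos
  have hsub (u : ℝ) : v - (bipolarIm (u, v) + 2 * Real.pi) ^ 2 = u - bipolarIm (u, v) ^ 2 := by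
    simp only [bipolarIm]
    field_simp
    ring
  have h₁' : (bipolarIm (u₁, v) + 2 * Real.pi) ^ 2 < v := by linarith [hsub u₁]
  have h₂' : (bipolarIm (u₂, v) + 2 * Real.pi) ^ 2 < v := by linarith [hsub u₂]
  have hv : 0 < v := (sq_nonneg _).trans_lt h₁'
  have e₁ := abs_le.1 (Real.abs_le_sqrt h₁'.le)
  have e₂ := abs_le.1 (Real.abs_le_sqrt h₂'.le)
  rw [circArc_eq_image (Real.sqrt_pos.2 hv) e₂.1 (by unfold bipolarIm; gcongr) e₁.2,
    Real.sq_sqrt hv.le]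
  have hpt (u : ℝ) : bipolarPt (u, v) + 2 * Real.pi * Complex.I =
      ⟨√(v - (bipolarIm (u, v) + 2 * Real.pi) ^ 2), bipolarIm (u, v) + 2 * Real.pi⟩ := by
    rw [hsub]
    apply Complex.ext <;> simp [bipolarPt]
  ext w
  constructor
  · rintro ⟨y, hy, rfl⟩
    have hy' : bipolarIm (v - 4 * Real.pi * y + 4 * Real.pi ^ 2, v) + 2 * Real.pi = y := by
      simp only [bipolarIm]
      field_simp
      ring
    refine ⟨(v - 4 * Real.pi * y + 4 * Real.pi ^ 2, v), ⟨?_, rfl⟩, by simp only [hpt, hy']⟩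
    have h1 := hy.1
    have h2 := hy.2
    rw [← hy'] at h1 h2
    simp only [bipolarIm, add_le_add_iff_right,
      div_le_div_iff_of_pos_right (show 0 < 4 * Real.pi by positivity)] at h1 h2
    constructor <;> linarith
  · rintro ⟨⟨u, v'⟩, ⟨hu', rfl : v' = v⟩, rfl⟩
    refine ⟨bipolarIm (u, v') + 2 * Real.pi, ⟨?_, ?_⟩, (hpt u).symm⟩ <;> unfold bipolarIm <;> gcongr
    exacts [hu'.2, hu'.1]

lemma expMap_add_two_pi_I (lam w : ℂ) : expMap lam (w + 2 * Real.pi * Complex.I) =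
    expMap lam w := by
  simp only [expMap, Complex.exp_periodic w]

lemma hasStrictDerivAt_expMap_comp (lam w : ℂ) :
    HasStrictDerivAt (expMap lam ∘ expMap lam) (expMap lam (expMap lam w) * expMap lam w) w := by
  have h (w : ℂ) : HasStrictDerivAt (expMap lam) (expMap lam w) w :=
    (Complex.hasStrictDerivAt_exp w).const_mul lam
  exact (h _).comp w (h w)

lemma expMap_ne_zero {lam : ℂ} (hlam : lam ≠ 0) (w : ℂ) : expMap lam w ≠ 0 :=
  mul_ne_zero hlam (Complex.exp_ne_zero w)

lemma exists_expMap_eq {lam z : ℂ} (hlam : lam ≠ 0) (hz : z ≠ 0) : ∃ w, expMap lam w = z := by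
  refine ⟨Complex.log (z / lam), ?_⟩
  rw [expMap, Complex.exp_log (div_ne_zero hz hlam), mul_div_cancel₀ _ hlam]

lemma exists_expMap_expMap_eq {lam z : ℂ} (hlam : lam ≠ 0) (hz : z ≠ 0) :
    ∃ w, expMap lam (expMap lam w) = z ∧ 0 < w.re := by
  obtain ⟨ζ₀, hζ₀⟩ := exists_expMap_eq hlam hz
  obtain ⟨n, hn⟩ := exists_nat_gt (‖lam‖ + ‖ζ₀‖)
  set ζ : ℂ := ζ₀ + n * (2 * Real.pi * Complex.I) with hζdef
  have hζ : expMap lam ζ = z := by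
    rw [← hζ₀, hζdef, expMap, Complex.exp_periodic.nat_mul n ζ₀, expMap]
  have hbig : ‖lam‖ < ‖ζ‖ := by
    have h1 : ‖(n : ℂ) * (2 * Real.pi * Complex.I)‖ = n * (2 * Real.pi) := by
      simp [abs_of_pos Real.pi_pos]
    have h2 : ‖(n : ℂ) * (2 * Real.pi * Complex.I)‖ ≤ ‖ζ‖ + ‖ζ₀‖ := by
      have := norm_sub_le ζ ζ₀
      rwa [hζdef, add_sub_cancel_left] at this
    have h3 : (n : ℝ) ≤ n * (2 * Real.pi) :=
      le_mul_of_one_le_right n.cast_nonneg (by linarith [Real.pi_gt_three])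
    linarith
  obtain ⟨w, hw⟩ := exists_expMap_eq hlam (norm_pos_iff.1 ((norm_nonneg lam).trans_lt hbig))
  refine ⟨w, by rw [hw, hζ], ?_⟩
  rw [← hw, expMap, norm_mul, Complex.norm_exp] at hbig
  have := (lt_mul_iff_one_lt_right (norm_pos_iff.2 hlam)).1 hbig
  exact Real.one_lt_exp_iff.1 this

lemma linearIndependent_mul_pair {D g c d : ℂ} (hD : D ≠ 0) (hg : g.re ≠ 0) (hc : c.re = 0)
    (hd : d.re = 0) (hcd : c ≠ d) :
    LinearIndependent ℝ ![D * (Complex.I * (g + c)), D * (Complex.I * (g + d))] := by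
  rw [LinearIndependent.pair_iff]
  intro s t h
  have h1 : (s : ℂ) * (g + c) + t * (g + d) = 0 := by
    have : D * Complex.I * ((s : ℂ) * (g + c) + t * (g + d)) = 0 := by
      rw [← h]
      simp only [Complex.real_smul]
      ring
    exact (mul_eq_zero.1 this).resolve_left (mul_ne_zero hD Complex.I_ne_zero)
  have h2 : (s + t) * g.re = 0 := by
    have := congrArg Complex.re h1
    simp [hc, hd] at this
    linarith
  have hst : t = -s := by linarith [(mul_eq_zero.1 h2).resolve_right hg]
  have h3 : (s : ℂ) * (c - d) = 0 := by
    rw [← h1, hst]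
    push_cast
    ring
  have hs : s = 0 := by
    exact_mod_cast (mul_eq_zero.1 h3).resolve_right (sub_ne_zero.2 hcd)
  exact ⟨hs, by rw [hst, hs, neg_zero]⟩

/-- The sides of the square with centre `c` and half side length `δ`. -/
def squareSide (c : ℝ × ℝ) (δ : ℝ) : Fin 4 → Set (ℝ × ℝ) :=
  ![{c.1 - δ} ×ˢ Icc (c.2 - δ) (c.2 + δ), {c.1 + δ} ×ˢ Icc (c.2 - δ) (c.2 + δ),
    Icc (c.1 - δ) (c.1 + δ) ×ˢ {c.2 - δ}, Icc (c.1 - δ) (c.1 + δ) ×ˢ {c.2 + δ}]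

/-- The translation taking the point with bipolar coordinates `P` to the circle centred at the
origin that corresponds to the `j`-th side of the square. -/
def sideShift : Fin 4 → ℂ :=
  ![0, 0, 2 * Real.pi * Complex.I, 2 * Real.pi * Complex.I]

lemma iUnion_squareSide (c : ℝ × ℝ) {δ : ℝ} (hδ : 0 < δ) :
    ⋃ j, squareSide c δ j = Metric.sphere c δ := by
  ext ⟨x, y⟩
  have habs (a b : ℝ) : (|a - b| ≤ δ ↔ b - δ ≤ a ∧ a ≤ b + δ) ∧
      (|a - b| = δ ↔ a = b - δ ∨ a = b + δ) := by
    grind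
  have hmax (a b : ℝ) : max a b = δ ↔ (a = δ ∧ b ≤ δ) ∨ (b = δ ∧ a ≤ δ) := by
    grind
  simp only [mem_sphere, Prod.dist_eq, Real.dist_eq, hmax, habs, mem_iUnion, Fin.exists_fin_succ,
    squareSide, mem_prod, mem_singleton_iff, mem_Icc, Matrix.cons_val_zero, Matrix.cons_val_succ,
    IsEmpty.exists_iff, or_false]
  tauto

lemma sideShift_ne {c : ℝ × ℝ} {δ : ℝ} (hδ : 0 < δ) {i j : Fin 4} (hij : i ≠ j) {P : ℝ × ℝ}
    (hi : P ∈ squareSide c δ i) (hj : P ∈ squareSide c δ j) : sideShift i ≠ sideShift j := by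
  have hne : (2 * Real.pi * Complex.I : ℂ) ≠ 0 := Complex.two_pi_I_ne_zero
  fin_cases i <;> fin_cases j <;> simp [squareSide, sideShift] at hij hi hj ⊢ <;> linarith

lemma sideShift_re (j : Fin 4) : (sideShift j).re = 0 := by
  fin_cases j <;> simp [sideShift]

lemma expMap_add_sideShift (lam w : ℂ) (j : Fin 4) :
    expMap lam (w + sideShift j) = expMap lam w := by
  fin_cases j <;> simp [sideShift, expMap_add_two_pi_I]

lemma exists_circArc_eq_image_squareSide {c : ℝ × ℝ} {δ : ℝ} (hδ : 0 < δ)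
    (h : ∀ P ∈ Metric.closedBall c δ, bipolarIm P ^ 2 < P.1) (j : Fin 4) :
    ∃ r α β : ℝ, 0 < r ∧ α ≤ β ∧
      circArc r α β = (fun P => bipolarPt P + sideShift j) '' squareSide c δ j := by
  have hpi := Real.pi_pos
  have hc (x y : ℝ) (hx : |x| ≤ δ) (hy : |y| ≤ δ) : bipolarIm (c.1 + x, c.2 + y) ^ 2 < c.1 + x :=
    h _ (by simp [Prod.dist_eq, hx, hy])
  have hp : |δ| ≤ δ := (abs_of_pos hδ).le
  have hm : |-δ| ≤ δ := (abs_neg δ).trans_le hp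
  have hpp := hc _ _ hp hp
  have hpm := hc _ _ hp hm
  have hmp := hc _ _ hm hp
  have hmm := hc _ _ hm hm
  simp only [← sub_eq_add_neg] at hpm hmp hmm
  have vert (u : ℝ) (h₁ : bipolarIm (u, c.2 - δ) ^ 2 < u) (h₂ : bipolarIm (u, c.2 + δ) ^ 2 < u) :
      ∃ r α β : ℝ, 0 < r ∧ α ≤ β ∧
        circArc r α β = bipolarPt '' ({u} ×ˢ Icc (c.2 - δ) (c.2 + δ)) := by
    refine ⟨_, _, _, Real.sqrt_pos.2 ((sq_nonneg _).trans_lt h₁), Real.monotone_arcsin ?_,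
      image_bipolarPt_vertical (by linarith) h₁ h₂⟩
    unfold bipolarIm
    gcongr
    linarith
  have horiz (v : ℝ) (h₁ : bipolarIm (c.1 - δ, v) ^ 2 < c.1 - δ)
      (h₂ : bipolarIm (c.1 + δ, v) ^ 2 < c.1 + δ) :
      ∃ r α β : ℝ, 0 < r ∧ α ≤ β ∧ circArc r α β =
        (fun P => bipolarPt P + 2 * Real.pi * Complex.I) '' (Icc (c.1 - δ) (c.1 + δ) ×ˢ {v}) := by
    refine ⟨_, _, _, Real.sqrt_pos.2 ?_, Real.monotone_arcsin ?_,
      image_bipolarPt_horizontal (by linarith) h₁ h₂⟩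
    · rw [← sub_pos] at h₁
      have : c.1 - δ - bipolarIm (c.1 - δ, v) ^ 2 =
          v - (bipolarIm (c.1 - δ, v) + 2 * Real.pi) ^ 2 := by
        simp only [bipolarIm]
        field_simp
        ring
      nlinarith
    · unfold bipolarIm
      gcongr
      linarith
  fin_cases j
  · simpa [sideShift, squareSide] using vert _ hmm hmp
  · simpa [sideShift, squareSide] using vert _ hpm hpp
  · simpa [sideShift, squareSide] using horiz _ hmm hpm
  · simpa [sideShift, squareSide] using horiz _ hmp hpp

/-- Given `ε > 0` and `z ≠ 0`, there are four closed circular arcs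
centred at the origin whose image under `f ∘ f` (`f = expMap lam`) is a Jordan curve
of diameter at most `ε` surrounding `z`, such that whenever the images of two distinct
arcs meet, they meet transversally. -/
theorem statement4 (lam : ℂ) (hlam : lam ≠ 0) (ε : ℝ) (hε : 0 < ε)
    (z : ℂ) (hz : z ≠ 0) :
    ∃ (r α β : Fin 4 → ℝ), (∀ j, 0 < r j) ∧ (∀ j, α j ≤ β j) ∧
      ∃ Γ : Set ℂ,
        Γ = (fun w => expMap lam (expMap lam w)) '' (⋃ j, circArc (r j) (α j) (β j)) ∧
        IsJordanCurve Γ ∧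
        Metric.diam Γ ≤ ε ∧
        z ∉ Γ ∧ Bornology.IsBounded (connectedComponentIn Γᶜ z) ∧
        ∀ i j, i ≠ j →
          ∀ p ∈ ((fun w => expMap lam (expMap lam w)) '' circArc (r i) (α i) (β i)) ∩
                ((fun w => expMap lam (expMap lam w)) '' circArc (r j) (α j) (β j)),
            ∀ w ∈ circArc (r i) (α i) (β i), ∀ w' ∈ circArc (r j) (α j) (β j),
              expMap lam (expMap lam w) = p → expMap lam (expMap lam w') = p →
                LinearIndependent ℝ
                  ![deriv (expMap lam ∘ expMap lam) w * (Complex.I * w),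
                    deriv (expMap lam ∘ expMap lam) w' * (Complex.I * w')] := by
  obtain ⟨w₀, hw₀, hre⟩ := exists_expMap_expMap_eq hlam hz
  set F : ℂ → ℂ := expMap lam ∘ expMap lam with hF
  have hFw₀ : F w₀ = z := hw₀
  have hderiv (w : ℂ) : deriv F w = expMap lam (expMap lam w) * expMap lam w :=
    (hasStrictDerivAt_expMap_comp lam w).hasDerivAt.deriv
  have hne (w : ℂ) : expMap lam (expMap lam w) * expMap lam w ≠ 0 :=
    mul_ne_zero (expMap_ne_zero hlam _) (expMap_ne_zero hlam _)
  have hFcont : Continuous F := continuous_iff_continuousAt.2 fun w =>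
    (hasStrictDerivAt_expMap_comp lam w).hasDerivAt.continuousAt
  have hFopen : IsOpenMap F := isOpenMap_of_hasStrictDerivAt
    (hasStrictDerivAt_expMap_comp lam) hne
  obtain ⟨W, hW, hWinj⟩ : ∃ W ∈ nhds w₀, InjOn F W := by
    have h := (hasStrictDerivAt_expMap_comp lam w₀).hasStrictFDerivAt_equiv (hne w₀)
    exact ⟨_, (h.toOpenPartialHomeomorph F).open_source.mem_nhds
      h.mem_toOpenPartialHomeomorph_source, (h.toOpenPartialHomeomorph F).injOn⟩
  set P₀ := bipolarCoord w₀ with hP₀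
  have hpt₀ : bipolarPt P₀ = w₀ := bipolarPt_bipolarCoord hre
  have hN : ∀ᶠ P in nhds P₀, bipolarIm P ^ 2 < P.1 ∧ bipolarPt P ∈ W ∧
      F (bipolarPt P) ∈ Metric.closedBall z (ε / 2) := by
    refine Filter.Eventually.and ?_ (Filter.Eventually.and ?_ ?_)
    · refine (continuous_bipolarIm.pow 2).continuousAt.eventually_lt continuous_fst.continuousAt ?_
      rw [hP₀, Pi.pow_apply, bipolarIm_bipolarCoord]
      simp only [bipolarCoord]
      nlinarith
    · apply continuous_bipolarPt.continuousAt
      rwa [hpt₀]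
    · apply (hFcont.comp continuous_bipolarPt).continuousAt
      simp only [comp_apply, hpt₀, hFw₀]
      exact closedBall_mem_nhds z (half_pos hε)
  obtain ⟨δ, hδ, hball⟩ := Metric.nhds_basis_closedBall.mem_iff.1 hN
  have hdom (P) (hP : P ∈ Metric.closedBall P₀ δ) : bipolarIm P ^ 2 < P.1 := (hball hP).1
  choose r α β hr hαβ harc using exists_circArc_eq_image_squareSide hδ hdom
  set Ψ : ℝ × ℝ → ℂ := fun P => F (bipolarPt P) with hΨ
  have hΨcont : Continuous Ψ := hFcont.comp continuous_bipolarPt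
  have hΨinj : InjOn Ψ (Metric.closedBall P₀ δ) := by
    intro P hP Q hQ h
    have := hWinj (hball hP).2.1 (hball hQ).2.1 h
    rw [← bipolarCoord_bipolarPt (hdom P hP), this, bipolarCoord_bipolarPt (hdom Q hQ)]
  have hΨopen : IsOpen (Ψ '' Metric.ball P₀ δ) := by
    have heq : Ψ '' Metric.ball P₀ δ =
        F '' ({w | 0 < w.re} ∩ bipolarCoord ⁻¹' Metric.ball P₀ δ) := by
      rw [hΨ, ← Set.image_image F bipolarPt]
      congr 1
      ext w
      constructor
      · rintro ⟨P, hP, rfl⟩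
        have hP' := hdom P (ball_subset_closedBall hP)
        refine ⟨bipolarPt_re_pos hP', ?_⟩
        rwa [mem_preimage, bipolarCoord_bipolarPt hP']
      · rintro ⟨hw, hw'⟩
        exact ⟨_, hw', bipolarPt_bipolarCoord hw⟩
    rw [heq]
    exact hFopen _ ((isOpen_lt continuous_const Complex.continuous_re).inter
      (isOpen_ball.preimage continuous_bipolarCoord))
  have hΓ : (fun w => expMap lam (expMap lam w)) '' (⋃ j, circArc (r j) (α j) (β j)) =
      Ψ '' Metric.sphere P₀ δ := by
    simp only [← iUnion_squareSide P₀ hδ, harc, Set.image_iUnion, Set.image_image,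
      expMap_add_sideShift]
    rfl
  obtain ⟨hnot, hbdd⟩ := isBounded_connectedComponentIn_compl_image_sphere hδ
    hΨcont.continuousOn hΨinj hΨopen
  have hΨP₀ : Ψ P₀ = z := by simp only [hΨ, hpt₀, hFw₀]
  rw [hΨP₀] at hnot hbdd
  refine ⟨r, α, β, hr, hαβ, Ψ '' Metric.sphere P₀ δ, hΓ.symm,
    isJordanCurve_image_sphere hδ hΨcont.continuousOn hΨinj, ?_, hnot, hbdd, ?_⟩
  · have hsub : Ψ '' Metric.sphere P₀ δ ⊆ Metric.closedBall z (ε / 2) := by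
      rintro _ ⟨P, hP, rfl⟩
      exact (hball (sphere_subset_closedBall hP)).2.2
    have := Metric.diam_le_of_subset_closedBall (half_pos hε).le hsub
    linarith
  · intro i j hij p _ w hw w' hw' hwp hwp'
    have hside (k) : squareSide P₀ δ k ⊆ Metric.closedBall P₀ δ :=
      (subset_iUnion (squareSide P₀ δ) k).trans
        ((iUnion_squareSide P₀ hδ).subset.trans sphere_subset_closedBall)
    rw [harc] at hw hw'
    obtain ⟨P, hP, rfl⟩ := hw
    obtain ⟨Q, hQ, rfl⟩ := hw'
    simp only [expMap_add_sideShift] at hwp hwp'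
    obtain rfl : P = Q := hΨinj (hside i hP) (hside j hQ) (hwp.trans hwp'.symm)
    simp only [hderiv, expMap_add_sideShift]
    exact linearIndependent_mul_pair (hne _) (bipolarPt_re_pos (hdom P (hside i hP))).ne'
      (sideShift_re i) (sideShift_re j) (sideShift_ne hδ hij hP hQ)
end
end
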